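/- arXiv:1911.05858 — 2 statements merged into one kernel-verified Lean document; each statement's English description precedes it below -/
import Mathlib

section
/- Let A be a block matrix over a field 𝔽 with n block rows/columns admitting an SSS representation with dimensions (r^h_i) and (r^g_i). Then for every 1 ≤ i ≤ n−1, rank(𝓗_i) ≤ r^h_i and rank(𝓖_i) ≤ r^g_i; that is, the dimensions of any SSS representation are bounded below by the corresponding Hankel block ranks. -/
open Matrix

variable {𝔽 : Type*} [Field 𝔽]

/-- The product of `d` consecutive transition matrices `W k * W (k+1) * ⋯ * W (k+d-1)`. -/
def sssChainAux (rg : ℕ → ℕ) (W : ∀ j, Matrix (Fin (rg j)) (Fin (rg (j + 1))) 𝔽) (k : ℕ) :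
    (d : ℕ) → Matrix (Fin (rg k)) (Fin (rg (k + d))) 𝔽
  | 0 => (1 : Matrix (Fin (rg k)) (Fin (rg k)) 𝔽)
  | d + 1 => sssChainAux rg W k d * W (k + d)

/-- The product of the transition matrices `W k * W (k+1) * ⋯ * W (ℓ-1)` (the identity when
`k = ℓ`, and junk `0` when `ℓ < k`). -/
def sssChain (rg : ℕ → ℕ) (W : ∀ j, Matrix (Fin (rg j)) (Fin (rg (j + 1))) 𝔽) (k ℓ : ℕ) :
    Matrix (Fin (rg k)) (Fin (rg ℓ)) 𝔽 :=
  if h : k ≤ ℓ then Nat.add_sub_cancel' h ▸ sssChainAux rg W k (ℓ - k) else 0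

/-- A sequentially semi-separable (SSS) representation of a block matrix `A` (with `n` block
rows/columns, block `k` of size `N k`, blocks indexed from `0`) with dimensions `rg`, `rh`
(`rg c`, `rh c` being the state dimensions at the cut between blocks `c` and `c + 1`, for
`0 ≤ c ≤ n - 2`): the diagonal blocks of `A` are `D k`; the strictly upper blocks are
`A_{k ℓ} = U k * W k * W (k+1) * ⋯ * W (ℓ - 2) * (V ℓ)ᵀ` for `k < ℓ`; and the strictly lower
blocks are `A_{k ℓ} = P k * R (k-2) * R (k-3) * ⋯ * R ℓ * (Q ℓ)ᵀ` for `ℓ < k`. -/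
def IsSSSRep {n : ℕ} (N : ℕ → ℕ)
    (A : Matrix ((k : Fin n) × Fin (N k)) ((k : Fin n) × Fin (N k)) 𝔽)
    (rg rh : ℕ → ℕ)
    (U : ∀ k, Matrix (Fin (N k)) (Fin (rg k)) 𝔽)
    (W : ∀ j, Matrix (Fin (rg j)) (Fin (rg (j + 1))) 𝔽)
    (V : ∀ k, Matrix (Fin (N k)) (Fin (rg (k - 1))) 𝔽)
    (D : ∀ k, Matrix (Fin (N k)) (Fin (N k)) 𝔽)
    (P : ∀ k, Matrix (Fin (N k)) (Fin (rh (k - 1))) 𝔽)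
    (R : ∀ j, Matrix (Fin (rh (j + 1))) (Fin (rh j)) 𝔽)
    (Q : ∀ k, Matrix (Fin (N k)) (Fin (rh k)) 𝔽) : Prop :=
  (∀ (k : Fin n) (i j : Fin (N k)), A ⟨k, i⟩ ⟨k, j⟩ = D k i j) ∧
  (∀ (k ℓ : Fin n), (k : ℕ) < (ℓ : ℕ) → ∀ (i : Fin (N k)) (j : Fin (N ℓ)),
      A ⟨k, i⟩ ⟨ℓ, j⟩ = (U k * sssChain rg W k ((ℓ : ℕ) - 1) * (V ℓ)ᵀ) i j) ∧
  (∀ (k ℓ : Fin n), (ℓ : ℕ) < (k : ℕ) → ∀ (i : Fin (N k)) (j : Fin (N ℓ)),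
      A ⟨k, i⟩ ⟨ℓ, j⟩ =
        (P k * (sssChain rh (fun j => (R j)ᵀ) ℓ ((k : ℕ) - 1))ᵀ * (Q ℓ)ᵀ) i j)

/-- The lower Hankel block `𝓗` at cut `c`: rows in blocks `{c+1, …, n-1}`, columns in blocks
`{0, …, c}`. -/
def lowerHankelBlock {n : ℕ} (N : ℕ → ℕ)
    (A : Matrix ((k : Fin n) × Fin (N k)) ((k : Fin n) × Fin (N k)) 𝔽) (c : ℕ) :
    Matrix {p : (k : Fin n) × Fin (N k) // c < (p.1 : ℕ)}
      {p : (k : Fin n) × Fin (N k) // (p.1 : ℕ) ≤ c} 𝔽 :=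
  Matrix.of fun i j => A i.1 j.1

/-- The upper Hankel block `𝓖` at cut `c`: rows in blocks `{0, …, c}`, columns in blocks
`{c+1, …, n-1}`. -/
def upperHankelBlock {n : ℕ} (N : ℕ → ℕ)
    (A : Matrix ((k : Fin n) × Fin (N k)) ((k : Fin n) × Fin (N k)) 𝔽) (c : ℕ) :
    Matrix {p : (k : Fin n) × Fin (N k) // (p.1 : ℕ) ≤ c}
      {p : (k : Fin n) × Fin (N k) // c < (p.1 : ℕ)} 𝔽 :=
  Matrix.of fun i j => A i.1 j.1

/-- The Hankel block `A_{S̄,S}` of a block matrix for a subset `S` of block indices. -/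
def blockHankel {n : ℕ} (N : ℕ → ℕ)
    (A : Matrix ((k : Fin n) × Fin (N k)) ((k : Fin n) × Fin (N k)) 𝔽) (S : Finset (Fin n)) :
    Matrix {p : (k : Fin n) × Fin (N k) // p.1 ∉ S}
      {p : (k : Fin n) × Fin (N k) // p.1 ∈ S} 𝔽 :=
  Matrix.of fun i j => A i.1 j.1

/-- `ρ_L(S)` for the line graph on `Fin n` with edges `{k, k+1}`: the number of edges with
exactly one endpoint in `S`. -/
def lineBorder (n : ℕ) (S : Finset (Fin n)) : ℕ :=
  (Finset.univ.filter fun p : Fin n × Fin n =>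
    (p.1 : ℕ) + 1 = (p.2 : ℕ) ∧ ¬((p.1 ∈ S) ↔ (p.2 ∈ S))).card

theorem sssChain_add (rg : ℕ → ℕ) (W : ∀ j, Matrix (Fin (rg j)) (Fin (rg (j + 1))) 𝔽) (k d : ℕ) :
    sssChain rg W k (k + d) = sssChainAux rg W k d := by
  have cast_eq : ∀ (e : ℕ) (h : k + e = k + d),
      (h ▸ sssChainAux rg W k e : Matrix (Fin (rg k)) (Fin (rg (k + d))) 𝔽) =
        sssChainAux rg W k d := by
    intro e h
    obtain rfl : e = d := Nat.add_left_cancel h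
    rfl
  rw [sssChain, dif_pos (Nat.le_add_right k d)]
  exact cast_eq _ _

theorem sssChain_self (rg : ℕ → ℕ) (W : ∀ j, Matrix (Fin (rg j)) (Fin (rg (j + 1))) 𝔽) (k : ℕ) :
    sssChain rg W k k = 1 :=
  sssChain_add rg W k 0

theorem sssChain_succ (rg : ℕ → ℕ) (W : ∀ j, Matrix (Fin (rg j)) (Fin (rg (j + 1))) 𝔽)
    {k m : ℕ} (h : k ≤ m) : sssChain rg W k (m + 1) = sssChain rg W k m * W m := by
  obtain ⟨d, rfl⟩ := Nat.exists_eq_add_of_le h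
  rw [sssChain_add]
  exact sssChain_add rg W k (d + 1)

theorem sssChain_mul_sssChain (rg : ℕ → ℕ)
    (W : ∀ j, Matrix (Fin (rg j)) (Fin (rg (j + 1))) 𝔽) {k c m : ℕ} (hkc : k ≤ c) (hcm : c ≤ m) :
    sssChain rg W k c * sssChain rg W c m = sssChain rg W k m := by
  induction m, hcm using Nat.le_induction with
  | base => rw [sssChain_self, Matrix.mul_one]
  | succ m hcm ih =>
    rw [sssChain_succ rg W hcm, sssChain_succ rg W (hkc.trans hcm), ← Matrix.mul_assoc, ih]

/-- A matrix whose entries are dot products of vectors of length `r` has rank at most `r`. -/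
theorem Matrix.rank_le_of_apply_eq_sum {ι κ : Type*} [Fintype κ] {r : ℕ} (M : Matrix ι κ 𝔽)
    (F : Matrix ι (Fin r) 𝔽) (G : Matrix (Fin r) κ 𝔽)
    (hM : ∀ i j, M i j = ∑ a, F i a * G a j) : M.rank ≤ r := by
  obtain rfl : M = F * G := Matrix.ext hM
  exact (Matrix.rank_mul_le_left F G).trans (by simpa using Matrix.rank_le_card_width F)

/-- The dimensions of any SSS representation of `A` are bounded below by
the corresponding Hankel block ranks: `rank 𝓗_c ≤ rh c` and `rank 𝓖_c ≤ rg c` for every cut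
`0 ≤ c < n - 1`. -/
theorem hankel_rank_le_sss_dims {n : ℕ} (N : ℕ → ℕ)
    (A : Matrix ((k : Fin n) × Fin (N k)) ((k : Fin n) × Fin (N k)) 𝔽)
    (rg rh : ℕ → ℕ)
    (U : ∀ k, Matrix (Fin (N k)) (Fin (rg k)) 𝔽)
    (W : ∀ j, Matrix (Fin (rg j)) (Fin (rg (j + 1))) 𝔽)
    (V : ∀ k, Matrix (Fin (N k)) (Fin (rg (k - 1))) 𝔽)
    (D : ∀ k, Matrix (Fin (N k)) (Fin (N k)) 𝔽)
    (P : ∀ k, Matrix (Fin (N k)) (Fin (rh (k - 1))) 𝔽)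
    (R : ∀ j, Matrix (Fin (rh (j + 1))) (Fin (rh j)) 𝔽)
    (Q : ∀ k, Matrix (Fin (N k)) (Fin (rh k)) 𝔽)
    (h : IsSSSRep N A rg rh U W V D P R Q) :
    ∀ c : ℕ, c < n - 1 →
      (lowerHankelBlock N A c).rank ≤ rh c ∧ (upperHankelBlock N A c).rank ≤ rg c := by
  obtain ⟨-, hU, hL⟩ := h
  intro c _
  constructor
  · refine Matrix.rank_le_of_apply_eq_sum _
      (Matrix.of fun p a =>
        (P p.1.1 * (sssChain rh (fun j => (R j)ᵀ) c ((p.1.1 : ℕ) - 1))ᵀ) p.1.2 a)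
      (Matrix.of fun a q =>
        ((sssChain rh (fun j => (R j)ᵀ) q.1.1 c)ᵀ * (Q q.1.1)ᵀ) a q.1.2) ?_
    rintro ⟨⟨k, i⟩, hk : c < (k : ℕ)⟩ ⟨⟨l, j⟩, hl : (l : ℕ) ≤ c⟩
    change A ⟨k, i⟩ ⟨l, j⟩ = _
    rw [hL k l (hl.trans_lt hk), ← sssChain_mul_sssChain rh _ hl (Nat.le_sub_one_of_lt hk),
      Matrix.transpose_mul, ← Matrix.mul_assoc, Matrix.mul_assoc, Matrix.mul_apply]
    rfl
  · refine Matrix.rank_le_of_apply_eq_sum _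
      (Matrix.of fun p a => (U p.1.1 * sssChain rg W p.1.1 c) p.1.2 a)
      (Matrix.of fun a q =>
        (sssChain rg W c ((q.1.1 : ℕ) - 1) * (V q.1.1)ᵀ) a q.1.2) ?_
    rintro ⟨⟨k, i⟩, hk : (k : ℕ) ≤ c⟩ ⟨⟨l, j⟩, hl : c < (l : ℕ)⟩
    change A ⟨k, i⟩ ⟨l, j⟩ = _
    rw [hU k l (hk.trans_lt hl), ← sssChain_mul_sssChain rg W hk (Nat.le_sub_one_of_lt hl),
      ← Matrix.mul_assoc, Matrix.mul_assoc, Matrix.mul_apply]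
    rfl
end

section
/- Let M be a block matrix over a field 𝔽 with row blocks of sizes N : V → ℕ and column blocks of sizes M : V → ℕ, indexed by the vertex set V of a finite simple graph G, such that the (v,w) block of M is zero whenever {v,w} is not an edge of G. Suppose every block of M has rank at most r. Then for every subset S ⊆ V, rank(M_{S̄,S}) ≤ r·ρ(S), where M_{S̄,S} is the submatrix with rows whose block index lies outside S and columns whose block index lies in S, and ρ(S) is the number of edges of G with exactly one endpoint in S. -/
open Matrix

variable {𝔽 : Type*} [Field 𝔽] {V : Type*} [Fintype V] [DecidableEq V]

/-- `ρ(S)`: the number of edges of `G` with exactly one endpoint in `S` (each such edge is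
counted once, as the ordered pair with first endpoint outside `S`). -/
def borderEdges (G : SimpleGraph V) [DecidableRel G.Adj] (S : Finset V) : ℕ :=
  (Finset.univ.filter fun p : V × V => G.Adj p.1 p.2 ∧ p.1 ∉ S ∧ p.2 ∈ S).card

theorem Matrix.rank_add_le {m n : Type*} [Finite m] [Fintype n] (A B : Matrix m n 𝔽) :
    (A + B).rank ≤ A.rank + B.rank := by
  rw [Matrix.rank, Matrix.mulVecLin_add]
  exact (Submodule.finrank_mono (LinearMap.range_add_le _ _)).trans
    (Submodule.finrank_add_le_finrank_add_finrank _ _)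

theorem Matrix.rank_sum_le {m n ι : Type*} [Finite m] [Fintype n] (s : Finset ι)
    (A : ι → Matrix m n 𝔽) : (∑ i ∈ s, A i).rank ≤ ∑ i ∈ s, (A i).rank := by
  classical
  induction s using Finset.induction_on with
  | empty => simp
  | insert a s ha ih =>
    rw [Finset.sum_insert ha, Finset.sum_insert ha]
    exact (Matrix.rank_add_le _ _).trans (Nat.add_le_add_left ih _)

/-- Extending a block by zeros to a matrix with rows `m` and columns `n` does not increase
the rank. -/
theorem Matrix.rank_mask_le {W : Type*} [DecidableEq W] {N M : W → ℕ} {m n : Type*} [Finite m] [Fintype n]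
    (B : Matrix ((v : W) × Fin (N v)) ((v : W) × Fin (M v)) 𝔽)
    (f : m → (v : W) × Fin (N v)) (g : n → (v : W) × Fin (M v)) (v w : W) :
    (Matrix.of fun p q => if (f p).1 = v ∧ (g q).1 = w then B (f p) (g q) else 0).rank ≤
      (Matrix.of fun (i : Fin (N v)) (j : Fin (M w)) => B ⟨v, i⟩ ⟨w, j⟩).rank := by
  let P : Matrix m (Fin (N v)) 𝔽 := Matrix.of fun p i => if f p = ⟨v, i⟩ then 1 else 0
  let Q : Matrix (Fin (M w)) n 𝔽 := Matrix.of fun j q => if g q = ⟨w, j⟩ then 1 else 0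
  have key : (Matrix.of fun p q => if (f p).1 = v ∧ (g q).1 = w then B (f p) (g q) else 0) =
      P * (Matrix.of fun (i : Fin (N v)) (j : Fin (M w)) => B ⟨v, i⟩ ⟨w, j⟩) * Q := by
    ext p q
    simp only [P, Q, Matrix.mul_apply, Matrix.of_apply]
    obtain ⟨v', i⟩ := f p
    obtain ⟨w', j⟩ := g q
    by_cases hv : v' = v
    · by_cases hw : w' = w
      · subst hv hw
        simp
      · simp [hw]
    · simp [hv]
  rw [key]
  exact (Matrix.rank_mul_le_left _ _).trans (Matrix.rank_mul_le_right _ _)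

/-- Let `B` be a block matrix whose `(v,w)` block vanishes whenever
`{v,w}` is not an edge of `G`, and suppose every block of `B` has rank at most `r`.
Then `rank(B_{S̄,S}) ≤ r · ρ(S)` for every subset `S ⊆ V`. -/
theorem rank_hankel_le_of_edge_supported (G : SimpleGraph V) [DecidableRel G.Adj]
    (N M : V → ℕ) (r : ℕ)
    (B : Matrix ((v : V) × Fin (N v)) ((v : V) × Fin (M v)) 𝔽)
    (hsupp : ∀ v w : V, ¬G.Adj v w → ∀ (i : Fin (N v)) (j : Fin (M w)), B ⟨v, i⟩ ⟨w, j⟩ = 0)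
    (hrank : ∀ v w : V,
      (Matrix.of fun (i : Fin (N v)) (j : Fin (M w)) => B ⟨v, i⟩ ⟨w, j⟩).rank ≤ r)
    (S : Finset V) :
    (Matrix.of fun (p : {p : (v : V) × Fin (N v) // p.1 ∉ S})
        (q : {q : (v : V) × Fin (M v) // q.1 ∈ S}) => B p.1 q.1).rank ≤
      r * borderEdges G S := by
  classical
  set E := Finset.univ.filter fun p : V × V => G.Adj p.1 p.2 ∧ p.1 ∉ S ∧ p.2 ∈ S with hE
  have key : (Matrix.of fun (p : {p : (v : V) × Fin (N v) // p.1 ∉ S})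
      (q : {q : (v : V) × Fin (M v) // q.1 ∈ S}) => B p.1 q.1) =
      ∑ e ∈ E, Matrix.of fun (p : {p : (v : V) × Fin (N v) // p.1 ∉ S})
        (q : {q : (v : V) × Fin (M v) // q.1 ∈ S}) =>
          if p.1.1 = e.1 ∧ q.1.1 = e.2 then B p.1 q.1 else 0 := by
    ext ⟨⟨v, i⟩, hv⟩ ⟨⟨w, j⟩, hw⟩
    have hiff (e : V × V) : (v = e.1 ∧ w = e.2) ↔ (v, w) = e := by
      rw [Prod.ext_iff]
    simp only [Matrix.sum_apply, Matrix.of_apply, hiff, Finset.sum_ite_eq]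
    split_ifs with h
    · rfl
    · exact hsupp v w (fun hadj => h (by simpa [hE] using ⟨hadj, hv, hw⟩)) i j
  rw [key]
  calc _ ≤ ∑ e ∈ E, _ := Matrix.rank_sum_le _ _
    _ ≤ ∑ _e ∈ E, r := Finset.sum_le_sum fun e _ =>
        (Matrix.rank_mask_le B Subtype.val Subtype.val e.1 e.2).trans (hrank e.1 e.2)
    _ = r * borderEdges G S := by rw [Finset.sum_const, smul_eq_mul, mul_comm, borderEdges]
end
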